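/- There exists a subgroup G ≤ W isomorphic to the direct product S₃ × S₃ of two symmetric groups on three letters such that: the action of G on the 56 exceptional classes has exactly five orbits, of lengths 2, 12, 12, 12, 18, with point stabilizers isomorphic to C₃ × S₃ (order 18), C₃, C₃, C₃, and C₂ respectively; G is minimal; G fixes a conic class; and G satisfies condition (H1). -/

import Mathlib

open scoped BigOperators

noncomputable section

/-- The Picard lattice of a degree 2 del Pezzo surface. -/
abbrev V : Type := Fin 8 → ℤ

/-- The intersection form. -/
def bil (x y : V) : ℤ := x 0 * y 0 - ∑ i ∈ Finset.Ioi (0 : Fin 8), x i * y i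

/-- The canonical class. -/
def Kvec : V := fun i => if i = 0 then -3 else 1

abbrev LatAut := V ≃ₗ[ℤ] V

/-- The Weyl group: automorphisms preserving the form and fixing K. -/
def W : Subgroup LatAut where
  carrier := {g | (∀ x y, bil (g x) (g y) = bil x y) ∧ g Kvec = Kvec}
  one_mem' := ⟨fun _ _ => rfl, rfl⟩
  mul_mem' := by
    rintro a b ⟨ha1, ha2⟩ ⟨hb1, hb2⟩
    refine ⟨fun x y => ?_, ?_⟩
    · show bil (a (b x)) (a (b y)) = bil x y
      rw [ha1, hb1]
    · show a (b Kvec) = Kvec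
      rw [hb2, ha2]
  inv_mem' := by
    rintro a ⟨ha1, ha2⟩
    refine ⟨fun x y => ?_, ?_⟩
    · have h := ha1 (a⁻¹ x) (a⁻¹ y)
      have hx : a (a⁻¹ x) = x := a.apply_symm_apply x
      have hy : a (a⁻¹ y) = y := a.apply_symm_apply y
      rw [hx, hy] at h
      exact h.symm
    · have h2 : a.symm (a Kvec) = a.symm Kvec := by rw [ha2]
      rw [a.symm_apply_apply] at h2
      exact (show a⁻¹ Kvec = a.symm Kvec from rfl).trans h2.symm

/-- Exceptional classes. -/
def Exc : Set V := {E | bil E E = -1 ∧ bil E Kvec = -1}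

/-- Conic classes. -/
def IsConic (C : V) : Prop := bil C C = 0 ∧ bil C Kvec = -2

/-- The orbit of a vector under a subgroup of `LatAut`. -/
def orb (G : Subgroup LatAut) (E : V) : Set V := {v | ∃ g ∈ G, g E = v}

/-- The set of orbits of exceptional classes. -/
def orbs (G : Subgroup LatAut) : Set (Set V) := {S | ∃ E ∈ Exc, S = orb G E}

/-- The stabilizer of a vector, as a subgroup of `LatAut`. -/
def stab (G : Subgroup LatAut) (E : V) : Subgroup LatAut where
  carrier := {g | g ∈ G ∧ g E = E}
  one_mem' := ⟨G.one_mem, rfl⟩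
  mul_mem' := by
    rintro a b ⟨haG, ha⟩ ⟨hbG, hb⟩
    exact ⟨G.mul_mem haG hbG, by show a (b E) = E; rw [hb, ha]⟩
  inv_mem' := by
    rintro a ⟨haG, ha⟩
    refine ⟨G.inv_mem haG, ?_⟩
    conv_lhs => rw [← ha]
    exact a.symm_apply_apply E

/-- `G` is minimal: no nonempty orbit of exceptional classes consists of pairwise
orthogonal classes. -/
def MinimalAction (G : Subgroup LatAut) : Prop :=
  ∀ E ∈ Exc, ¬ (∀ E₁ ∈ orb G E, ∀ E₂ ∈ orb G E, E₁ ≠ E₂ → bil E₁ E₂ = 0)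

/-- The natural representation of a subgroup of `LatAut` on the lattice. -/
def rep (G : Subgroup LatAut) : Representation ℤ G V where
  toFun g := (g : LatAut).toLinearMap
  map_one' := rfl
  map_mul' _ _ := rfl

/-- Condition (H1): the first group cohomology of every subgroup of `G`
with coefficients in the lattice vanishes. -/
def CondH1 (G : Subgroup LatAut) : Prop :=
  ∀ G' : Subgroup LatAut, G' ≤ G →
    Subsingleton (groupCohomology.H1 (Rep.of (rep G')))

/-- The intersection form as a bilinear map. -/
def bilForm : V →ₗ[ℤ] V →ₗ[ℤ] ℤ :=
  LinearMap.mk₂ ℤ bil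
    (fun x y z => by simp only [bil, Pi.add_apply, add_mul, Finset.sum_add_distrib]; ring)
    (fun c x y => by
      simp only [bil, Pi.smul_apply, smul_eq_mul, mul_assoc, mul_sub, Finset.mul_sum])
    (fun x y z => by simp only [bil, Pi.add_apply, mul_add, Finset.sum_add_distrib]; ring)
    (fun c x y => by
      simp only [bil, Pi.smul_apply, smul_eq_mul, mul_left_comm _ c, mul_sub, Finset.mul_sum])

@[simp]
theorem bilForm_apply (x y : V) : bilForm x y = bil x y := rfl

theorem bil_comm (x y : V) : bil x y = bil y x := by
  simp only [bil, mul_comm]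

theorem bil_eq (x y : V) : bil x y = 2 * (x 0 * y 0) - ∑ i, x i * y i := by
  have h : (Finset.Ioi (0 : Fin 8)) = Finset.univ.erase 0 := by decide
  rw [bil, h, ← Finset.add_sum_erase Finset.univ _ (Finset.mem_univ (0 : Fin 8))]
  ring

/-- A fibre class of a conic bundle structure. -/
def conic : V := ![1, 0, 0, 0, 0, 0, 0, -1]

/-- The automorphism permuting the coordinates. -/
def permAut : Equiv.Perm (Fin 8) →* LatAut where
  toFun s := LinearEquiv.funCongrLeft ℤ ℤ s⁻¹
  map_one' := rfl
  map_mul' _ _ := rfl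

theorem permAut_apply (s : Equiv.Perm (Fin 8)) (v : V) (i : Fin 8) :
    permAut s v i = v (s⁻¹ i) := rfl

theorem bil_permAut {s : Equiv.Perm (Fin 8)} (hs : s 0 = 0) (x y : V) :
    bil (permAut s x) (permAut s y) = bil x y := by
  have h0 : s⁻¹ 0 = 0 := Equiv.Perm.inv_eq_iff_eq.2 hs.symm
  simp only [bil_eq, permAut_apply, h0]
  rw [Equiv.sum_comp s⁻¹ fun i => x i * y i]

theorem permAut_Kvec {s : Equiv.Perm (Fin 8)} (hs : s 0 = 0) : permAut s Kvec = Kvec := by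
  funext i
  simp only [permAut_apply, Kvec, Equiv.Perm.inv_eq_iff_eq, hs]

theorem permAut_conic {s : Equiv.Perm (Fin 8)} (hs : s 0 = 0) (hs' : s 7 = 7) :
    permAut s conic = conic := by
  have h : conic = fun i => if i = 0 then 1 else if i = 7 then -1 else 0 := by decide
  funext i
  simp only [permAut_apply, h, Equiv.Perm.inv_eq_iff_eq, hs, hs']

theorem bil_Kvec_Kvec : bil Kvec Kvec = 2 := by decide

theorem bil_conic_Kvec : bil conic Kvec = -2 := by decide

theorem bil_conic_conic : bil conic conic = 0 := by decide

/-- Minus the identity on the orthogonal complement of the canonical and conic classes,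
the identity on their span. -/
def fibreSwapLin : V →ₗ[ℤ] V :=
  -LinearMap.id - (bilForm conic).smulRight Kvec - (bilForm (conic + Kvec)).smulRight conic

theorem fibreSwapLin_apply (v : V) :
    fibreSwapLin v = -v - bil conic v • Kvec - (bil conic v + bil Kvec v) • conic := by
  simp [fibreSwapLin]

theorem bil_conic_fibreSwapLin (v : V) : bil conic (fibreSwapLin v) = bil conic v := by
  rw [fibreSwapLin_apply, ← bilForm_apply]
  simp only [map_sub, map_neg, map_smul, bilForm_apply, smul_eq_mul, bil_conic_Kvec,
    bil_conic_conic]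
  ring

theorem bil_Kvec_fibreSwapLin (v : V) : bil Kvec (fibreSwapLin v) = bil Kvec v := by
  rw [fibreSwapLin_apply, ← bilForm_apply]
  simp only [map_sub, map_neg, map_smul, bilForm_apply, smul_eq_mul, bil_comm Kvec conic,
    bil_conic_Kvec, bil_Kvec_Kvec]
  ring

theorem fibreSwapLin_involutive : Function.Involutive fibreSwapLin := by
  intro v
  rw [fibreSwapLin_apply (fibreSwapLin v), bil_conic_fibreSwapLin, bil_Kvec_fibreSwapLin,
    fibreSwapLin_apply]
  module

/-- The involution swapping the two components of each singular fibre of the conic bundle. -/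
def fibreSwap : LatAut := LinearEquiv.ofInvolutive fibreSwapLin fibreSwapLin_involutive

theorem fibreSwap_apply (v : V) :
    fibreSwap v = -v - bil conic v • Kvec - (bil conic v + bil Kvec v) • conic :=
  fibreSwapLin_apply v

theorem fibreSwap_mul_self : fibreSwap * fibreSwap = 1 :=
  LinearEquiv.ext fibreSwapLin_involutive

theorem bil_fibreSwap (x y : V) : bil (fibreSwap x) (fibreSwap y) = bil x y := by
  have hc : bil conic (fibreSwap y) = bil conic y := bil_conic_fibreSwapLin y
  have hK : bil Kvec (fibreSwap y) = bil Kvec y := bil_Kvec_fibreSwapLin y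
  rw [fibreSwap_apply x, ← bilForm_apply]
  simp only [map_sub, map_neg, map_smul, LinearMap.sub_apply, LinearMap.neg_apply,
    LinearMap.smul_apply, bilForm_apply, smul_eq_mul, hc, hK]
  rw [fibreSwap_apply y, ← bilForm_apply]
  simp only [map_sub, map_neg, map_smul, bilForm_apply, smul_eq_mul, bil_comm x Kvec,
    bil_comm x conic]
  ring

theorem fibreSwap_Kvec : fibreSwap Kvec = Kvec := by
  rw [fibreSwap_apply, bil_conic_Kvec, bil_Kvec_Kvec]
  module

theorem fibreSwap_conic : fibreSwap conic = conic := by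
  rw [fibreSwap_apply, bil_conic_conic, bil_comm Kvec, bil_conic_Kvec]
  module

/-- The symmetric group on three letters, realized as a dihedral group. -/
abbrev D3 : Type := DihedralGroup 3

/-- The coordinate attached to an element of the dihedral group. -/
def slot : D3 → Fin 8
  | .r i => ![1, 2, 3] i
  | .sr i => ![4, 5, 6] i

/-- The element attached to a coordinate, with junk value `1` at the coordinates `0` and `7`. -/
def unslot : Fin 8 → D3 :=
  ![1, .r 0, .r 1, .r 2, .sr 0, .sr 1, .sr 2, 1]

theorem unslot_slot : ∀ x, unslot (slot x) = x := by decide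

theorem slot_unslot : ∀ i, ¬(i = 0 ∨ i = 7) → slot (unslot i) = i := by decide

theorem slot_ne : ∀ x, ¬(slot x = 0 ∨ slot x = 7) := by decide

/-- The character of the dihedral group that is trivial on rotations. -/
def dihedralSign : D3 →* ℤˣ where
  toFun
    | .r _ => 1
    | .sr _ => -1
  map_one' := rfl
  map_mul' := by decide

/-- The action of `D₃ × D₃` on the coordinates induced by left and right translations of `D₃`. -/
def coordPerm : D3 × D3 →* Equiv.Perm (Fin 8) :=
  MonoidHom.toHomPerm
    { toFun g i := if i = 0 ∨ i = 7 then i else slot (g.1 * unslot i * g.2⁻¹)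
      map_one' := by
        funext i
        by_cases h : i = 0 ∨ i = 7
        · simp only [h, if_true]; rfl
        · simp only [h, if_false, Prod.fst_one, Prod.snd_one, one_mul, inv_one, mul_one]
          exact slot_unslot i h
      map_mul' g k := by
        funext i
        change _ = ite _ _ _
        by_cases h : i = 0 ∨ i = 7
        · simp only [h, if_true]
        · simp only [h, if_false, slot_ne, unslot_slot, Prod.fst_mul, Prod.snd_mul, mul_inv_rev,
            mul_assoc] }

theorem coordPerm_zero (g : D3 × D3) : coordPerm g 0 = 0 := rfl

theorem coordPerm_seven (g : D3 × D3) : coordPerm g 7 = 7 := rfl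

theorem commute_fibreSwap_permAut (g : D3 × D3) : Commute fibreSwap (permAut (coordPerm g)) := by
  refine LinearEquiv.ext fun v => ?_
  set p := permAut (coordPerm g)
  have hK : p Kvec = Kvec := permAut_Kvec (coordPerm_zero g)
  have hc : p conic = conic := permAut_conic (coordPerm_zero g) (coordPerm_seven g)
  have hbK : bil Kvec (p v) = bil Kvec v := by
    conv_lhs => rw [← hK]
    exact bil_permAut (coordPerm_zero g) _ _
  have hbc : bil conic (p v) = bil conic v := by
    conv_lhs => rw [← hc]
    exact bil_permAut (coordPerm_zero g) _ _
  change fibreSwap (p v) = p (fibreSwap v)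
  rw [fibreSwap_apply, fibreSwap_apply, hbK, hbc]
  simp only [map_sub, map_neg, map_smul, hK, hc]

/-- The powers of `fibreSwap`. -/
def swapPow : ℤˣ →* LatAut where
  toFun u := if u = 1 then 1 else fibreSwap
  map_one' := rfl
  map_mul' u v := by
    rcases Int.units_eq_one_or u with rfl | rfl <;> rcases Int.units_eq_one_or v with rfl | rfl <;>
      simp [fibreSwap_mul_self]

theorem swapPow_cases (u : ℤˣ) : swapPow u = 1 ∨ swapPow u = fibreSwap := by
  rcases Int.units_eq_one_or u with rfl | rfl
  exacts [Or.inl rfl, Or.inr rfl]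

/-- The action of `D₃ × D₃` on the lattice: it permutes the singular fibres of the conic bundle,
identified with the elements of `D₃`, by left and right translations, and the reflections in the
first factor swap the components of the fibres. -/
def latAct : D3 × D3 →* LatAut where
  toFun g := swapPow (dihedralSign g.1) * permAut (coordPerm g)
  map_one' := by simp
  map_mul' g k := by
    have h : Commute (swapPow (dihedralSign k.1)) (permAut (coordPerm g)) := by
      rcases swapPow_cases (dihedralSign k.1) with h | h <;> rw [h]
      exacts [Commute.one_left _, commute_fibreSwap_permAut g]
    simp only [Prod.fst_mul, map_mul]
    exact h.mul_mul_mul_comm _ _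

theorem latAct_conic (g : D3 × D3) : latAct g conic = conic := by
  have hp := permAut_conic (coordPerm_zero g) (coordPerm_seven g)
  change swapPow (dihedralSign g.1) (permAut (coordPerm g) conic) = conic
  rw [hp]
  rcases swapPow_cases (dihedralSign g.1) with h | h <;> rw [h]
  exacts [rfl, fibreSwap_conic]

theorem latAct_mem_W (g : D3 × D3) : latAct g ∈ W := by
  refine W.mul_mem ?_ ⟨bil_permAut (coordPerm_zero g), permAut_Kvec (coordPerm_zero g)⟩
  rcases swapPow_cases (dihedralSign g.1) with h | h <;> rw [h]
  exacts [W.one_mem, ⟨bil_fibreSwap, fibreSwap_Kvec⟩]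

theorem latAct_injective : Function.Injective latAct := by
  have key : ∀ g : D3 × D3, latAct g ![0, 1, 2, 3, 4, 5, 6, 0] = ![0, 1, 2, 3, 4, 5, 6, 0] →
      g = 1 := by
    decide +kernel
  exact (injective_iff_map_eq_one latAct).2 fun g hg => key g (by rw [hg]; rfl)

/-- Representatives of the orbits of exceptional classes. -/
def orbRep : Fin 5 → V :=
  ![![0, 0, 0, 0, 0, 0, 0, 1], ![0, 0, 0, 0, 0, 0, 1, 0], ![1, -1, -1, 0, 0, 0, 0, 0],
    ![2, -1, -1, -1, -1, -1, 0, 0], ![1, -1, 0, 0, -1, 0, 0, 0]]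

/-- The orders of the stabilizers of the representatives. -/
def stabOrder : Fin 5 → ℕ := ![18, 3, 3, 3, 2]

theorem orbRep_mem_Exc (j : Fin 5) : orbRep j ∈ Exc := by
  have key : ∀ j, bil (orbRep j) (orbRep j) = -1 ∧ bil (orbRep j) Kvec = -1 := by decide
  exact key j

theorem card_filter_latAct_orbRep :
    ∀ j, (Finset.univ.filter fun g => latAct g (orbRep j) = orbRep j).card = stabOrder j := by
  decide +kernel

theorem exists_bil_orbRep_ne_zero :
    ∀ j, ∃ g, latAct g (orbRep j) ≠ orbRep j ∧ bil (latAct g (orbRep j)) (orbRep j) ≠ 0 := by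
  decide +kernel

/-- A box containing all exceptional classes. -/
def excBox (p : Fin 4 × (Fin 7 → Fin 2)) : V :=
  Matrix.vecCons (p.1 : ℤ) fun i => ![0, -1, -1, -2] p.1 + (p.2 i : ℤ)

theorem card_filter_excBox :
    (Finset.univ.filter fun p => bil (excBox p) Kvec = -1 ∧ bil (excBox p) (excBox p) = -1).card =
      56 := by
  decide +kernel

/-- Pairs of vectors whose orbits decompose the identity of the lattice. -/
def splitSeed : Fin 3 → V × V :=
  ![(![0, 0, 0, 0, 0, 0, 1, 0], ![1, 0, 0, 0, -1, 0, -1, 0]),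
    (![1, -1, -1, -1, 0, 0, 0, 0], ![2, -1, -1, -1, 0, 0, 0, -1]),
    (![-2, 0, 0, 0, 0, 0, 0, 1], ![0, 0, 0, 0, 0, 0, 0, 1])]

/-- A finite stable set of pairs of vectors decomposing the identity of the lattice. -/
def splitPairs : Finset (V × V) :=
  Finset.univ.image fun p : (D3 × D3) × Fin 3 =>
    (latAct p.1 (splitSeed p.2).1, latAct p.1 (splitSeed p.2).2)

theorem sum_splitPairs_single :
    ∀ k : Fin 8, ∑ p ∈ splitPairs, bil p.1 (Pi.single k 1) • p.2 = Pi.single k 1 := by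
  decide +kernel

theorem sum_splitPairs (v : V) : ∑ p ∈ splitPairs, bil p.1 v • p.2 = v := by
  have h : ∑ p ∈ splitPairs, (bilForm p.1).smulRight p.2 = LinearMap.id := by
    refine LinearMap.pi_ext' fun k => LinearMap.ext_ring ?_
    simpa [LinearMap.sum_apply] using sum_splitPairs_single k
  simpa [LinearMap.sum_apply] using LinearMap.congr_fun h v

theorem latAct_mem_splitPairs (g : D3 × D3) {p : V × V} (hp : p ∈ splitPairs) :
    (latAct g p.1, latAct g p.2) ∈ splitPairs := by
  obtain ⟨⟨k, j⟩, -, rfl⟩ := Finset.mem_image.1 hp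
  refine Finset.mem_image.2 ⟨(g * k, j), Finset.mem_univ _, ?_⟩
  simp only [map_mul]
  rfl

/-- If a finite set of pairs, stable under a finite group of isometries, exhibits the lattice as a
direct summand of a permutation module, then the first cohomology group of the lattice vanishes. -/
theorem subsingleton_H1_of_sum_eq {G : Subgroup LatAut} [Finite G]
    (hG : ∀ g ∈ G, ∀ x y, bil (g x) (g y) = bil x y) {X : Finset (V × V)}
    (hX : ∀ g ∈ G, ∀ p ∈ X, (g p.1, g p.2) ∈ X) (hsum : ∀ v, ∑ p ∈ X, bil p.1 v • p.2 = v) :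
    Subsingleton (groupCohomology.H1 (Rep.of (rep G))) := by
  have : Fintype G := Fintype.ofFinite G
  suffices h : ∀ x : groupCohomology.H1 (Rep.of (rep G)), x = 0 from
    ⟨fun x y => (h x).trans (h y).symm⟩
  intro x
  induction x using groupCohomology.H1_induction_on with | _ f
  rw [groupCohomology.H1π_eq_zero_iff]
  let F : G → V := f
  have hf : ∀ g h : G, F (g * h) = g.1 (F h) + F g :=
    (groupCohomology.mem_cocycles₁_iff (A := Rep.of (rep G)) f).1 f.2
  change F ∈ groupCohomology.coboundaries₁ (Rep.of (rep G))
  set n : ℤ := (Fintype.card G : ℤ)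
  have hn : n ≠ 0 := by simp [n, Fintype.card_ne_zero]
  set S : V := ∑ h, F h
  have hS (g : G) : g.1 S = S - n • F g := by
    have : S = g.1 S + n • F g := by
      calc S = ∑ h, F (g * h) := (Equiv.sum_comp (Equiv.mulLeft g) F).symm
        _ = g.1 S + n • F g := by simp [hf, S, n, Finset.sum_add_distrib]
    rw [eq_sub_iff_add_eq, ← this]
  set t : V := ∑ p ∈ X, (bil p.1 S / n) • p.2
  have ht (g : G) : g.1 t = t - F g := by
    have hbij : ∑ p ∈ X, (bil (g.1 p.1) (g.1 S) / n) • g.1 p.2 =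
        ∑ p ∈ X, (bil p.1 (g.1 S) / n) • p.2 := by
      refine Finset.sum_bij' (fun p _ => (g.1 p.1, g.1 p.2))
        (fun p _ => (g.1⁻¹ p.1, g.1⁻¹ p.2)) (fun p hp => hX _ g.2 p hp)
        (fun p hp => hX _ (G.inv_mem g.2) p hp) ?_ ?_ (fun _ _ => rfl)
      · exact fun p _ => Prod.ext (g.1.symm_apply_apply _) (g.1.symm_apply_apply _)
      · exact fun p _ => Prod.ext (g.1.apply_symm_apply _) (g.1.apply_symm_apply _)
    calc g.1 t = ∑ p ∈ X, (bil (g.1 p.1) (g.1 S) / n) • g.1 p.2 := by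
          simp only [t, map_sum, map_smul, hG _ g.2]
      _ = ∑ p ∈ X, (bil p.1 (S - n • F g) / n) • p.2 := by rw [hbij, hS]
      _ = ∑ p ∈ X, (bil p.1 S / n - bil p.1 (F g)) • p.2 := by
          refine Finset.sum_congr rfl fun p _ => ?_
          rw [← bilForm_apply, map_sub, map_smul, smul_eq_mul, bilForm_apply, bilForm_apply,
            Int.sub_mul_ediv_left _ _ hn]
      _ = t - F g := by simp only [sub_smul, Finset.sum_sub_distrib, hsum, t]
  refine ⟨-t, funext fun g => ?_⟩
  change g.1 (-t) - -t = F g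
  rw [map_neg, ht]
  abel

theorem orb_eq_orbit (G : Subgroup LatAut) (E : V) : orb G E = MulAction.orbit G E := by
  ext v
  exact ⟨fun ⟨g, hg, h⟩ => ⟨⟨g, hg⟩, h⟩, fun ⟨g, h⟩ => ⟨g, g.2, h⟩⟩

theorem orb_eq_of_mem {G : Subgroup LatAut} {E E' : V} (h : E' ∈ orb G E) :
    orb G E' = orb G E := by
  rw [orb_eq_orbit] at *
  rw [orb_eq_orbit]
  exact MulAction.orbit_eq_iff.2 h

theorem self_mem_orb (G : Subgroup LatAut) (E : V) : E ∈ orb G E := ⟨1, G.one_mem, rfl⟩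

theorem ncard_orb_mul_card_stab (G : Subgroup LatAut) (E : V) :
    (orb G E).ncard * Nat.card (stab G E) = Nat.card G := by
  have hs : stab G E = (MulAction.stabilizer G E).map G.subtype := by
    ext g
    exact ⟨fun h => ⟨⟨g, h.1⟩, h.2, rfl⟩, by rintro ⟨k, hk, rfl⟩; exact ⟨k.2, hk⟩⟩
  rw [hs, Subgroup.card_map_of_injective G.subtype_injective, orb_eq_orbit,
    ← Nat.card_coe_set_eq, ← Nat.card_prod]
  exact Nat.card_congr (MulAction.orbitProdStabilizerEquivGroup G E)

theorem card_range_latAct : Nat.card latAct.range = 36 := by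
  rw [← Nat.card_congr (MonoidHom.ofInjective latAct_injective).toEquiv, Nat.card_prod,
    DihedralGroup.nat_card]

theorem card_stab_orbRep (j : Fin 5) : Nat.card (stab latAct.range (orbRep j)) = stabOrder j := by
  have h : (stab latAct.range (orbRep j) : Set LatAut) = latAct ''
      (Finset.univ.filter fun g => latAct g (orbRep j) = orbRep j : Finset (D3 × D3)) := by
    ext g
    constructor
    · rintro ⟨⟨k, rfl⟩, hk⟩
      exact ⟨k, by simpa using hk, rfl⟩
    · rintro ⟨k, hk, rfl⟩
      exact ⟨⟨k, rfl⟩, by simpa using hk⟩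
  rw [← SetLike.coe_sort_coe, Nat.card_coe_set_eq, h,
    Set.ncard_image_of_injective _ latAct_injective, Set.ncard_coe_finset,
    card_filter_latAct_orbRep]

/-- The lengths of the orbits of the representatives. -/
def orbLen : Fin 5 → ℕ := ![2, 12, 12, 12, 18]

theorem ncard_orb_orbRep (j : Fin 5) : (orb latAct.range (orbRep j)).ncard = orbLen j := by
  have h := ncard_orb_mul_card_stab latAct.range (orbRep j)
  rw [card_stab_orbRep, card_range_latAct] at h
  have key : ∀ j, 0 < stabOrder j ∧ orbLen j * stabOrder j = 36 := by decide
  exact Nat.eq_of_mul_eq_mul_right (key j).1 (h.trans (key j).2.symm)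

theorem orb_orbRep_injective : Function.Injective fun j => orb latAct.range (orbRep j) := by
  intro j k h
  replace h : orb latAct.range (orbRep j) = orb latAct.range (orbRep k) := h
  have hlen : orbLen j = orbLen k := by rw [← ncard_orb_orbRep, h, ncard_orb_orbRep]
  have hmem : orbRep j ∈ orb latAct.range (orbRep k) := h ▸ self_mem_orb _ _
  obtain ⟨_, ⟨g, rfl⟩, hg⟩ := hmem
  have hbil : bil conic (orbRep j) = bil conic (orbRep k) := by
    rw [← hg, ← (latAct_mem_W g).1 conic (orbRep k), latAct_conic]
  have key : ∀ j k, orbLen j = orbLen k → bil conic (orbRep j) = bil conic (orbRep k) →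
      j = k := by
    decide +kernel
  exact key j k hlen hbil

theorem exists_eq_add_fin_two {y : Fin 7 → ℤ} {c : ℤ}
    (h : ∑ i, y i ^ 2 - (2 * c + 1) * ∑ i, y i + 7 * (c * (c + 1)) = 0) :
    ∃ s : Fin 7 → Fin 2, ∀ i, y i = c + (s i : ℤ) := by
  have hsum : ∑ i, (y i - c) * (y i - c - 1) = 0 := by
    rw [← h, Finset.mul_sum, ← Finset.sum_sub_distrib]
    have : (7 : ℤ) * (c * (c + 1)) = ∑ _i : Fin 7, c * (c + 1) := by simp
    rw [this, ← Finset.sum_add_distrib]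
    exact Finset.sum_congr rfl fun i _ => by ring
  have hnonneg (m : ℤ) : 0 ≤ m * (m - 1) := by
    rcases le_or_gt m 0 with hm | hm
    · exact mul_nonneg_of_nonpos_of_nonpos hm (by lia)
    · exact mul_nonneg hm.le (by lia)
  rw [Finset.sum_eq_zero_iff_of_nonneg fun i _ => hnonneg _] at hsum
  have hy (i : Fin 7) : ∃ b : Fin 2, y i = c + (b : ℤ) := by
    rcases mul_eq_zero.1 (hsum i (Finset.mem_univ i)) with h | h
    · exact ⟨0, by simp; lia⟩
    · exact ⟨1, by simp; lia⟩
  choose s hs using hy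
  exact ⟨s, hs⟩

theorem exists_excBox_eq {E : V} (hE : E ∈ Exc) : ∃ p, excBox p = E := by
  obtain ⟨h1, h2⟩ := hE
  rw [bil_eq, Fin.sum_univ_succ] at h1 h2
  simp only [Kvec, Fin.succ_ne_zero, if_true, if_false, mul_one, ← pow_two] at h1 h2
  obtain ⟨x, hx⟩ : ∃ x, x = E 0 := ⟨_, rfl⟩
  obtain ⟨y, hy⟩ : ∃ y : Fin 7 → ℤ, y = fun i => E i.succ := ⟨_, rfl⟩
  have hEq : E = Matrix.vecCons x y := by
    subst hx hy
    exact (Fin.cons_self_tail E).symm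
  have hs2 : ∑ i, y i ^ 2 = x ^ 2 + 1 := by subst hx hy; linarith
  have hs1 : ∑ i, y i = 1 - 3 * x := by subst hx hy; linarith
  have hCS := sq_sum_le_card_mul_sum_sq (s := Finset.univ) (f := y)
  rw [hs1, hs2] at hCS
  simp only [Finset.card_univ, Fintype.card_fin, Nat.cast_ofNat] at hCS
  have hx0 : 0 ≤ x := by nlinarith
  have hx3 : x ≤ 3 := by nlinarith
  obtain ⟨k, hk⟩ : ∃ k : Fin 4, (k : ℤ) = x := ⟨⟨x.toNat, by lia⟩, by simp [hx0]⟩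
  obtain ⟨s, hs⟩ := exists_eq_add_fin_two (y := y) (c := ![0, -1, -1, -2] k) (by
    rw [hs1, hs2, ← hk]
    clear hk
    decide +revert)
  refine ⟨(k, s), ?_⟩
  rw [hEq, excBox, hk]
  exact congrArg _ (funext fun i => (hs i).symm)

theorem orb_orbRep_subset_Exc (j : Fin 5) : orb latAct.range (orbRep j) ⊆ Exc := by
  rintro _ ⟨_, ⟨g, rfl⟩, rfl⟩
  obtain ⟨h1, h2⟩ := latAct_mem_W g
  obtain ⟨hE1, hE2⟩ := orbRep_mem_Exc j
  refine ⟨(h1 _ _).trans hE1, ?_⟩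
  rw [← h2, h1, hE2]

theorem exists_mem_orb_orbRep {E : V} (hE : E ∈ Exc) : ∃ j, E ∈ orb latAct.range (orbRep j) := by
  classical
  have : Finite latAct.range := Nat.finite_of_card_ne_zero (by rw [card_range_latAct]; decide)
  have hfin (j : Fin 5) : (orb latAct.range (orbRep j)).Finite := by
    rw [orb_eq_orbit]
    exact Set.finite_range _
  set O : Fin 5 → Finset V := fun j => (hfin j).toFinset
  set B : Finset V := (Finset.univ.filter fun p =>
    bil (excBox p) Kvec = -1 ∧ bil (excBox p) (excBox p) = -1).image excBox
  have hB : B.card ≤ 56 := Finset.card_image_le.trans card_filter_excBox.le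
  have hExcB {v : V} (hv : v ∈ Exc) : v ∈ B := by
    obtain ⟨p, rfl⟩ := exists_excBox_eq hv
    exact Finset.mem_image_of_mem _ (by simpa using hv.symm)
  have hdisj : ((Finset.univ : Finset (Fin 5)) : Set (Fin 5)).PairwiseDisjoint O := by
    intro j _ k _ hjk
    refine Finset.disjoint_left.2 fun v hj hk => hjk (orb_orbRep_injective ?_)
    simp only [O, Set.Finite.mem_toFinset] at hj hk
    exact (orb_eq_of_mem hj).symm.trans (orb_eq_of_mem hk)
  have hcard : (Finset.univ.biUnion O).card = 56 := by
    rw [Finset.card_biUnion hdisj]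
    simp only [O, ← Set.ncard_eq_toFinset_card, ncard_orb_orbRep]
    decide
  have hsub : Finset.univ.biUnion O ⊆ B := fun v hv => by
    obtain ⟨j, -, hj⟩ := Finset.mem_biUnion.1 hv
    exact hExcB (orb_orbRep_subset_Exc j ((hfin j).mem_toFinset.1 hj))
  have hEB := hExcB hE
  rw [← Finset.eq_of_subset_of_card_le hsub (hB.trans hcard.ge)] at hEB
  obtain ⟨j, -, hj⟩ := Finset.mem_biUnion.1 hEB
  exact ⟨j, (hfin j).mem_toFinset.1 hj⟩

theorem orbs_range_latAct : orbs latAct.range = Set.range fun j => orb latAct.range (orbRep j) := by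
  ext S
  constructor
  · rintro ⟨E, hE, rfl⟩
    obtain ⟨j, hj⟩ := exists_mem_orb_orbRep hE
    exact ⟨j, (orb_eq_of_mem hj).symm⟩
  · rintro ⟨j, rfl⟩
    exact ⟨_, orbRep_mem_Exc j, rfl⟩

theorem ncard_orbs_of_ncard_eq (n : ℕ) :
    {S ∈ orbs latAct.range | S.ncard = n}.ncard =
      (Finset.univ.filter fun j => orbLen j = n).card := by
  have h : {S ∈ orbs latAct.range | S.ncard = n} = (fun j => orb latAct.range (orbRep j)) ''
      (Finset.univ.filter fun j => orbLen j = n : Finset (Fin 5)) := by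
    rw [orbs_range_latAct]
    ext S
    constructor
    · rintro ⟨⟨j, rfl⟩, hj⟩
      exact ⟨j, by simpa [ncard_orb_orbRep] using hj, rfl⟩
    · rintro ⟨j, hj, rfl⟩
      exact ⟨⟨j, rfl⟩, by simpa [ncard_orb_orbRep] using hj⟩
  rw [h, Set.ncard_image_of_injective _ orb_orbRep_injective, Set.ncard_coe_finset]

/-- The rotations of the dihedral group. -/
def dihedralRotation : Multiplicative (ZMod 3) →* D3 where
  toFun i := .r i.toAdd
  map_one' := rfl
  map_mul' _ _ := rfl

theorem dihedralRotation_injective : Function.Injective dihedralRotation :=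
  fun _ _ h => DihedralGroup.r.inj h

theorem exists_mulEquiv_perm : Nonempty (D3 ≃* Equiv.Perm (Fin 3)) := by
  let f : D3 →* Equiv.Perm (Fin 3) :=
    { toFun
        | .r i => Equiv.subRight (i : Fin 3)
        | .sr i => Equiv.subLeft (i : Fin 3)
      map_one' := by decide
      map_mul' := by decide }
  have hf : Function.Injective f := by decide
  refine ⟨MulEquiv.ofBijective f ((Fintype.bijective_iff_injective_and_card f).2 ⟨hf, ?_⟩)⟩
  decide

theorem latAct_orbRep_zero_eq_self_iff :
    ∀ g, latAct g (orbRep 0) = orbRep 0 ↔ dihedralSign g.1 = 1 := by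
  decide +kernel

theorem latAct_eq_self_iff (g k : D3 × D3) :
    latAct g (latAct k (orbRep 0)) = latAct k (orbRep 0) ↔ dihedralSign g.1 = 1 := by
  have h : latAct g (latAct k (orbRep 0)) = latAct k (latAct (k⁻¹ * g * k) (orbRep 0)) := by
    change (latAct g * latAct k) (orbRep 0) = (latAct k * latAct (k⁻¹ * g * k)) (orbRep 0)
    rw [← map_mul, ← map_mul]
    group
  rw [h, (latAct k).injective.eq_iff, latAct_orbRep_zero_eq_self_iff]
  simp only [Prod.fst_mul, Prod.fst_inv, map_mul, map_inv]
  rw [mul_right_comm, inv_mul_cancel, one_mul]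

theorem exists_mulEquiv_stab {E : V} (hE : E ∈ orb latAct.range (orbRep 0)) :
    Nonempty (stab latAct.range E ≃* (Multiplicative (ZMod 3) × Equiv.Perm (Fin 3))) := by
  obtain ⟨e⟩ := exists_mulEquiv_perm
  obtain ⟨_, ⟨k, rfl⟩, rfl⟩ := hE
  let f : Multiplicative (ZMod 3) × D3 →* LatAut :=
    latAct.comp (dihedralRotation.prodMap (MonoidHom.id D3))
  have hf : Function.Injective f :=
    latAct_injective.comp (dihedralRotation_injective.prodMap Function.injective_id)
  have hrange : f.range = stab latAct.range (latAct k (orbRep 0)) := by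
    ext g
    constructor
    · rintro ⟨p, rfl⟩
      exact ⟨⟨_, rfl⟩, (latAct_eq_self_iff _ k).2 rfl⟩
    · rintro ⟨⟨⟨a, b⟩, rfl⟩, hg⟩
      have ha := (latAct_eq_self_iff (a, b) k).1 hg
      rcases a with i | i
      · exact ⟨(Multiplicative.ofAdd i, b), rfl⟩
      · exact absurd ha (by change ¬((-1 : ℤˣ) = 1); decide)
  exact ⟨(MulEquiv.subgroupCongr hrange).symm.trans ((MonoidHom.ofInjective hf).symm.trans
    ((MulEquiv.refl _).prodCongr e))⟩

theorem exists_dp2_S3xS3_conic :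
    ∃ G : Subgroup LatAut, G ≤ W ∧
      Nonempty (G ≃* (Equiv.Perm (Fin 3) × Equiv.Perm (Fin 3))) ∧
      (orbs G).ncard = 5 ∧
      {S ∈ orbs G | S.ncard = 2}.ncard = 1 ∧
      {S ∈ orbs G | S.ncard = 12}.ncard = 3 ∧
      {S ∈ orbs G | S.ncard = 18}.ncard = 1 ∧
      (∀ E ∈ Exc,
        ((orb G E).ncard = 2 →
          Nonempty (stab G E ≃* (Multiplicative (ZMod 3) × Equiv.Perm (Fin 3)))) ∧
        ((orb G E).ncard = 12 → IsCyclic (stab G E) ∧ Nat.card (stab G E) = 3) ∧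
        ((orb G E).ncard = 18 → IsCyclic (stab G E) ∧ Nat.card (stab G E) = 2)) ∧
      MinimalAction G ∧
      (∃ C, IsConic C ∧ ∀ g ∈ G, g C = C) ∧
      CondH1 G := by
  have hW : latAct.range ≤ W := by
    rintro _ ⟨g, rfl⟩
    exact latAct_mem_W g
  have hfin : Finite latAct.range := Nat.finite_of_card_ne_zero (by rw [card_range_latAct]; decide)
  obtain ⟨e⟩ := exists_mulEquiv_perm
  refine ⟨latAct.range, hW, ⟨(MonoidHom.ofInjective latAct_injective).symm.trans (e.prodCongr e)⟩,
    ?_, ?_, ?_, ?_, fun E hE => ⟨fun h => ?_, fun h => ?_, fun h => ?_⟩, fun E hE h => ?_,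
    ⟨conic, ⟨bil_conic_conic, bil_conic_Kvec⟩, ?_⟩, fun G' hG' => ?_⟩
  · rw [orbs_range_latAct, ← Set.image_univ, Set.ncard_image_of_injective _ orb_orbRep_injective,
      Set.ncard_univ, Nat.card_fin]
  · rw [ncard_orbs_of_ncard_eq]; decide
  · rw [ncard_orbs_of_ncard_eq]; decide
  · rw [ncard_orbs_of_ncard_eq]; decide
  · obtain ⟨j, hj⟩ := exists_mem_orb_orbRep hE
    rw [orb_eq_of_mem hj, ncard_orb_orbRep] at h
    have key : ∀ j, orbLen j = 2 → j = 0 := by decide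
    exact exists_mulEquiv_stab (key j h ▸ hj)
  · have hcard := ncard_orb_mul_card_stab latAct.range E
    rw [h, card_range_latAct] at hcard
    have h3 : Nat.card (stab latAct.range E) = 3 := by lia
    have : Fact (Nat.Prime 3) := ⟨Nat.prime_three⟩
    exact ⟨isCyclic_of_prime_card h3, h3⟩
  · have hcard := ncard_orb_mul_card_stab latAct.range E
    rw [h, card_range_latAct] at hcard
    have h2 : Nat.card (stab latAct.range E) = 2 := by lia
    exact ⟨isCyclic_of_prime_card h2, h2⟩
  · obtain ⟨j, hj⟩ := exists_mem_orb_orbRep hE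
    rw [orb_eq_of_mem hj] at h
    obtain ⟨g, hne, hbil⟩ := exists_bil_orbRep_ne_zero j
    exact hbil (h _ ⟨_, ⟨g, rfl⟩, rfl⟩ _ (self_mem_orb _ _) hne)
  · rintro _ ⟨g, rfl⟩
    exact latAct_conic g
  · have : Finite G' := Finite.of_injective _ (Subgroup.inclusion_injective hG')
    refine subsingleton_H1_of_sum_eq (fun g hg => (hW (hG' hg)).1) (fun g hg p hp => ?_)
      sum_splitPairs
    obtain ⟨k, rfl⟩ := hG' hg
    exact latAct_mem_splitPairs k hp

end
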